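/- Let f and g be random functions ℝ^d → ℝ (jointly measurable, and almost surely C¹) such that for every x ∈ ℝ^d, f(x) and g(x) are equal in distribution as real random variables. Then for every x ∈ ℝ^d, the random gradients ∇f(x) and ∇g(x) are equal in distribution as ℝ^d-valued random variables. -/

import Mathlib

open MeasureTheory Filter Topology

lemma stmt6_aux {Ω : Type*} [MeasurableSpace Ω] (P : Measure Ω) [IsProbabilityMeasure P]
    {d : ℕ} (f : Ω → EuclideanSpace ℝ (Fin d) → ℝ)
    (hfm : Measurable (Function.uncurry f))
    (hfC1 : ∀ᵐ ω ∂P, ContDiff ℝ 1 (f ω))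
    (hgradf : ∀ x, Measurable fun ω => gradient (f ω) x)
    (x v : EuclideanSpace ℝ (Fin d)) (s : ℝ) :
    Tendsto (fun n : ℕ => ∫ p : ℝ × ℝ,
        Complex.exp (((s * ((n + 1 : ℕ) * (p.1 - p.2)) : ℝ) : ℂ) * Complex.I)
        ∂(P.map (fun ω => (f ω (x + (1 / ((n + 1 : ℕ) : ℝ)) • v), f ω x)))) atTop
      (𝓝 (charFun (P.map (fun ω => gradient (f ω) x)) (s • v))) := by
  have hm : ∀ y, Measurable fun ω => f ω y := fun y =>
    hfm.comp (measurable_id.prodMk measurable_const)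
  rw [charFun_apply, integral_map (hgradf x).aemeasurable (by fun_prop)]
  have e : ∀ n : ℕ, (∫ p : ℝ × ℝ,
        Complex.exp (((s * ((n + 1 : ℕ) * (p.1 - p.2)) : ℝ) : ℂ) * Complex.I)
        ∂(P.map (fun ω => (f ω (x + (1 / ((n + 1 : ℕ) : ℝ)) • v), f ω x)))) =
      ∫ ω, Complex.exp (((s * ((n + 1 : ℕ) *
        (f ω (x + (1 / ((n + 1 : ℕ) : ℝ)) • v) - f ω x)) : ℝ) : ℂ) * Complex.I) ∂P := by
    intro n
    rw [integral_map ((hm _).prodMk (hm _)).aemeasurable]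
    exact (Continuous.aestronglyMeasurable (by fun_prop))
  simp_rw [e]
  apply tendsto_integral_of_dominated_convergence (fun _ => (1 : ℝ))
  · intro n
    have h1 := hm (x + (1 / ((n + 1 : ℕ) : ℝ)) • v)
    have h2 := hm x
    exact Measurable.aestronglyMeasurable (by fun_prop)
  · exact integrable_const _
  · intro n
    filter_upwards with ω
    rw [Complex.norm_exp_ofReal_mul_I]
  · filter_upwards [hfC1] with ω hω
    have hd : DifferentiableAt ℝ (f ω) x := (hω.differentiable (by norm_num)) x
    have hg := hd.hasGradientAt.hasFDerivAt
    have hc : Tendsto (fun n : ℕ => ‖((n + 1 : ℕ) : ℝ)‖) atTop atTop := by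
      simp only [Real.norm_natCast]
      exact tendsto_natCast_atTop_atTop.comp (tendsto_add_atTop_nat 1)
    have hl := hg.lim v hc
    have hcont : Continuous fun r : ℝ => Complex.exp (((s * r : ℝ) : ℂ) * Complex.I) := by
      fun_prop
    have := (hcont.tendsto _).comp hl
    simpa [Function.comp_def, inner_smul_right] using this

/-- If two random a.s.-`C¹` functions `f, g : Ω × ℝ^d → ℝ` have pointwise
equal distributions (including joint distributions of the difference-quotient pairs),
then their random gradients are pointwise equal in distribution. -/
theorem stmt6 {Ω : Type*} [MeasurableSpace Ω] (P : Measure Ω) [IsProbabilityMeasure P]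
    {d : ℕ}
    (f g : Ω → EuclideanSpace ℝ (Fin d) → ℝ)
    (hfm : Measurable (Function.uncurry f)) (hgm : Measurable (Function.uncurry g))
    (hfC1 : ∀ᵐ ω ∂P, ContDiff ℝ 1 (f ω)) (hgC1 : ∀ᵐ ω ∂P, ContDiff ℝ 1 (g ω))
    (hgradf : ∀ x, Measurable fun ω => gradient (f ω) x)
    (hgradg : ∀ x, Measurable fun ω => gradient (g ω) x)
    (heq : ∀ x, P.map (fun ω => f ω x) = P.map (fun ω => g ω x))
    (hpair : ∀ (x v : EuclideanSpace ℝ (Fin d)), ‖v‖ = 1 → ∀ n : ℕ, 0 < n →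
      P.map (fun ω => (f ω (x + (1 / (n : ℝ)) • v), f ω x))
        = P.map (fun ω => (g ω (x + (1 / (n : ℝ)) • v), g ω x))) :
    ∀ x, P.map (fun ω => gradient (f ω) x) = P.map (fun ω => gradient (g ω) x) := by
  intro x
  haveI := Measure.isProbabilityMeasure_map (μ := P) (hgradf x).aemeasurable
  haveI := Measure.isProbabilityMeasure_map (μ := P) (hgradg x).aemeasurable
  apply Measure.ext_of_charFun
  ext t
  by_cases ht : t = 0
  · subst ht
    simp
  have hv : ‖(‖t‖⁻¹ : ℝ) • t‖ = 1 := by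
    rw [norm_smul, norm_inv, norm_norm, inv_mul_cancel₀ (norm_ne_zero_iff.mpr ht)]
  have hF := stmt6_aux P f hfm hfC1 hgradf x (‖t‖⁻¹ • t) ‖t‖
  have hG := stmt6_aux P g hgm hgC1 hgradg x (‖t‖⁻¹ • t) ‖t‖
  rw [smul_inv_smul₀ (norm_ne_zero_iff.mpr ht)] at hF hG
  simp_rw [fun n : ℕ => hpair x _ hv (n + 1) n.succ_pos] at hF
  exact tendsto_nhds_unique hF hG
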